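/- Let Ω be the non-obtuse triangle in ℝ² with vertices A, B, C (affinely independent, with all three angles at most π/2, i.e., (B−A)·(C−A) ≥ 0, (A−B)·(C−B) ≥ 0, (A−C)·(B−C) ≥ 0). Then the minimal unfolded region Uf(Ω) is contained in the medial triangle of Ω, i.e., in the convex hull of the three midpoints (A+B)/2, (B+C)/2, (C+A)/2 of the edges. -/

import Mathlib

open Set MeasureTheory Filter Asymptotics Metric
open scoped Topology RealInnerProductSpace

noncomputable section

/-- `m`-dimensional Euclidean space. -/
abbrev Euc (m : ℕ) := EuclideanSpace ℝ (Fin m)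

/-- A body: the closure of a nonempty bounded open set. -/
def IsBody {m : ℕ} (Ω : Set (Euc m)) : Prop :=
  ∃ U : Set (Euc m), IsOpen U ∧ U.Nonempty ∧ Bornology.IsBounded U ∧ Ω = closure U

/-- The potential `K_Ω(x) = ∫_Ω k(|x - y|) dy`. -/
def pot {m : ℕ} (k : ℝ → ℝ) (Ω : Set (Euc m)) (x : Euc m) : ℝ :=
  ∫ y in Ω, k (dist x y)

/-- Condition `(C⁰_α)`. -/
def CondC0 (m : ℕ) (α : ℝ) (k : ℝ → ℝ) : Prop :=
  ContinuousOn k (Ioi 0) ∧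
  (α < m → k =O[𝓝[>] (0:ℝ)] fun r : ℝ => r ^ (α - m)) ∧
  (α = m → k =O[𝓝[>] (0:ℝ)] fun r : ℝ => Real.log r) ∧
  ((m : ℝ) < α → k =O[𝓝[>] (0:ℝ)] fun _ : ℝ => (1:ℝ))

/-- Condition `(C¹_α)`. -/
def CondC1 (m : ℕ) (α : ℝ) (k : ℝ → ℝ) : Prop :=
  ContDiffOn ℝ 1 k (Ioi 0) ∧
  (α < m → k =O[𝓝[>] (0:ℝ)] fun r : ℝ => r ^ (α - m)) ∧
  (α = m → k =O[𝓝[>] (0:ℝ)] fun r : ℝ => Real.log r) ∧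
  ((m : ℝ) < α → k =O[𝓝[>] (0:ℝ)] fun _ : ℝ => (1:ℝ)) ∧
  (α < m + 1 → deriv k =O[𝓝[>] (0:ℝ)] fun r : ℝ => r ^ (α - m - 1)) ∧
  (α = m + 1 → deriv k =O[𝓝[>] (0:ℝ)] fun r : ℝ => Real.log r) ∧
  ((m : ℝ) + 1 < α → deriv k =O[𝓝[>] (0:ℝ)] fun _ : ℝ => (1:ℝ))

/-- Reflection of `ℝ^m` in the hyperplane `{z : z ⬝ v = b}` (for a unit vector `v`). -/
def reflAt {m : ℕ} (v : Euc m) (b : ℝ) (z : Euc m) : Euc m :=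
  z + (2 * (b - ⟪z, v⟫)) • v

/-- `Ω⁺_{v,b}`, the part of `Ω` of height at least `b` in direction `v`. -/
def upSet {m : ℕ} (Ω : Set (Euc m)) (v : Euc m) (b : ℝ) : Set (Euc m) :=
  {z ∈ Ω | b ≤ ⟪z, v⟫}

/-- The minimum folding height `l(v)`. -/
def foldHeight {m : ℕ} (Ω : Set (Euc m)) (v : Euc m) : ℝ :=
  sInf {a : ℝ | ∀ b ≥ a, reflAt v b '' upSet Ω v b ⊆ Ω}

/-- The minimal unfolded region `Uf(Ω)`. -/
def unfolded {m : ℕ} (Ω : Set (Euc m)) : Set (Euc m) :=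
  ⋂ v ∈ sphere (0 : Euc m) 1, {z : Euc m | ⟪z, v⟫ ≤ foldHeight Ω v}

/-- `Ω` is convex in the direction `v`: every line parallel to `v` meets `Ω` in a connected set. -/
def ConvexInDir {m : ℕ} (Ω : Set (Euc m)) (v : Euc m) : Prop :=
  ∀ z : Euc m, ⟪z, v⟫ = 0 → IsPreconnected (Ω ∩ {w : Euc m | ∃ t : ℝ, w = z + t • v})

/-- `d(Ω) = min {|z - w| : z ∈ Uf(Ω), w ∈ ∂Ω}`. -/
def dMin {m : ℕ} (Ω : Set (Euc m)) : ℝ :=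
  sInf {d : ℝ | ∃ z ∈ unfolded Ω, ∃ w ∈ frontier Ω, d = dist z w}

/-- `D(Ω) = max {|z - w| : z ∈ Uf(Ω), w ∈ ∂Ω}`. -/
def dMax {m : ℕ} (Ω : Set (Euc m)) : ℝ :=
  sSup {d : ℝ | ∃ z ∈ unfolded Ω, ∃ w ∈ frontier Ω, d = dist z w}

/-- The `r^{α-m}`-potential `V^{(α)}_Ω`. -/
def rpot (m : ℕ) (α : ℝ) (Ω : Set (Euc m)) (x : Euc m) : ℝ :=
  if α = (m : ℝ) then -∫ y in Ω, Real.log (dist x y)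
  else Real.sign ((m : ℝ) - α) * ∫ y in Ω, dist x y ^ (α - (m : ℝ))

/-- The solid-angle (Poisson) potential `A_Ω(x, h)`. -/
def apot (m : ℕ) (Ω : Set (Euc m)) (x : Euc m) (h : ℝ) : ℝ :=
  ∫ y in Ω, h / (dist x y ^ 2 + h ^ 2) ^ (((m : ℝ) + 1) / 2)

section triangle
variable {E : Type*} [AddCommGroup E] [Module ℝ E]

lemma mem_convexHull_triple_iff {A B C x : E} :
    x ∈ convexHull ℝ {A, B, C} ↔ ∃ a b c : ℝ, 0 ≤ a ∧ 0 ≤ b ∧ 0 ≤ c ∧ a + b + c = 1 ∧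
      a • A + b • B + c • C = x := by
  constructor
  · refine fun hx ↦ convexHull_min (t := {x | ∃ a b c : ℝ, 0 ≤ a ∧ 0 ≤ b ∧ 0 ≤ c ∧
      a + b + c = 1 ∧ a • A + b • B + c • C = x}) ?_ ?_ hx
    · rintro y (rfl | rfl | rfl)
      · exact ⟨1, 0, 0, by norm_num, by norm_num, by norm_num, by norm_num, by simp⟩
      · exact ⟨0, 1, 0, by norm_num, by norm_num, by norm_num, by norm_num, by simp⟩
      · exact ⟨0, 0, 1, by norm_num, by norm_num, by norm_num, by norm_num, by simp⟩
    · rintro _ ⟨a, b, c, ha, hb, hc, h, rfl⟩ _ ⟨a', b', c', ha', hb', hc', h', rfl⟩ p q hp hq hpq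
      refine ⟨p * a + q * a', p * b + q * b', p * c + q * c', by positivity, by positivity,
        by positivity, ?_, by module⟩
      linear_combination p * h + q * h' + hpq
  · rintro ⟨a, b, c, ha, hb, hc, h, rfl⟩
    have := (convex_convexHull ℝ {A, B, C}).sum_mem (t := Finset.univ) (w := ![a, b, c])
      (z := ![A, B, C])
    simp only [Fin.sum_univ_three] at this
    refine this (fun i _ ↦ ?_) h (fun i _ ↦ subset_convexHull _ _ ?_)
    · fin_cases i <;> assumption
    · fin_cases i <;> simp

end triangle

lemma inner_reflAt {m : ℕ} {v : Euc m} (hv : ‖v‖ = 1) (b : ℝ) (z : Euc m) :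
    ⟪reflAt v b z, v⟫ = 2 * b - ⟪z, v⟫ := by
  rw [reflAt, inner_add_left, real_inner_smul_left, real_inner_self_eq_norm_sq, hv]
  ring

/-- Folding a set that is bounded below by the height of one of its points `B` cannot go below
that height. -/
lemma bddBelow_foldHeights {m : ℕ} {Ω : Set (Euc m)} {v B : Euc m} (hv : ‖v‖ = 1) (hB : B ∈ Ω)
    (hmin : ∀ z ∈ Ω, ⟪B, v⟫ ≤ ⟪z, v⟫) :
    BddBelow {a : ℝ | ∀ b ≥ a, reflAt v b '' upSet Ω v b ⊆ Ω} := by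
  refine ⟨⟪B, v⟫, fun a ha ↦ ?_⟩
  by_contra! h
  have := hmin _ (ha a le_rfl (mem_image_of_mem _ ⟨hB, h.le⟩))
  rw [inner_reflAt hv] at this
  linarith

/-- The minimal unfolded region lies in the half of the triangle away from the vertex `A`. -/
lemma barycentric_le_half_of_mem_unfolded {m : ℕ} {A B C : Euc m}
    (h : ¬ Collinear ℝ {A, B, C}) (hB : 0 ≤ ⟪A - B, C - B⟫) (hC : 0 ≤ ⟪A - C, B - C⟫)
    {a b c : ℝ} (habc : a + b + c = 1)
    (hz : a • A + b • B + c • C ∈ unfolded (convexHull ℝ {A, B, C})) : a ≤ 1 / 2 := by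
  have hBC : C - B ≠ 0 := by
    intro h0
    rw [sub_eq_zero] at h0
    subst h0
    exact h (by simpa using collinear_pair ℝ A C)
  have hBCpos : 0 < ‖C - B‖ ^ 2 := by positivity
  obtain ⟨s, hs⟩ : ∃ s, s * ‖C - B‖ ^ 2 = ⟪A - B, C - B⟫ := ⟨_, div_mul_cancel₀ _ hBCpos.ne'⟩
  have hs0 : 0 ≤ s := by
    by_contra! h0
    nlinarith
  have hs1 : s ≤ 1 := by
    have : ⟪A - C, B - C⟫ = ‖C - B‖ ^ 2 - ⟪A - B, C - B⟫ := by
      rw [← real_inner_self_eq_norm_sq, ← inner_sub_left, ← neg_sub C B, inner_neg_right,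
        ← inner_neg_left]
      congr 1
      abel
    rw [this, ← hs] at hC
    by_contra! h0
    nlinarith
  set w := A - B - s • (C - B) with hw
  have hA : A = (1 - s) • B + s • C + w := by rw [hw]; module
  have hwBC : ⟪C - B, w⟫ = 0 := by
    rw [hw, inner_sub_right, real_inner_smul_right, real_inner_self_eq_norm_sq,
      real_inner_comm, hs, sub_self]
  have hw0 : w ≠ 0 := by
    intro h0
    refine h (collinear_insert_of_mem_affineSpan_pair ?_)
    rw [hA, h0]
    convert AffineMap.lineMap_mem_affineSpan_pair s B C using 1
    rw [AffineMap.lineMap_apply_module]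
    simp
  have hn : 0 < ‖w‖ := by positivity
  set v := ‖w‖⁻¹ • w with hv
  have hv1 : ‖v‖ = 1 := norm_smul_inv_norm hw0
  have hinner : ∀ a b c : ℝ, a + b + c = 1 → ⟪a • A + b • B + c • C, v⟫ = ⟪B, v⟫ + a * ‖w‖ := by
    intro a b c h1
    have : a • A + b • B + c • C = B + (a * s + c) • (C - B) + a • w := by
      rw [hA, show b = 1 - a - c by linarith]
      module
    rw [this, hv, inner_add_left, inner_add_left, real_inner_smul_left (C - B),
      real_inner_smul_right (C - B), hwBC, real_inner_smul_left w, real_inner_smul_right w,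
      real_inner_self_eq_norm_sq]
    field_simp
    ring
  have hfold : foldHeight (convexHull ℝ {A, B, C}) v ≤ ⟪B, v⟫ + ‖w‖ / 2 := by
    refine csInf_le (bddBelow_foldHeights (B := B) hv1 (subset_convexHull _ _ (by simp)) ?_) ?_
    · intro z hz
      obtain ⟨a, b, c, ha, hb, hc, h1, rfl⟩ := mem_convexHull_triple_iff.1 hz
      rw [hinner a b c h1]
      have := mul_nonneg ha hn.le
      linarith
    · rintro d hd _ ⟨z, ⟨hz, hzd⟩, rfl⟩
      obtain ⟨a, b, c, ha, hb, hc, h1, rfl⟩ := mem_convexHull_triple_iff.1 hz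
      obtain ⟨t, rfl⟩ : ∃ t, d = ⟪B, v⟫ + t * ‖w‖ := ⟨(d - ⟪B, v⟫) / ‖w‖, by field_simp; ring⟩
      rw [hinner a b c h1] at hzd
      have hta : t ≤ a := le_of_mul_le_mul_right (by linarith) hn
      have ht : 1 / 2 ≤ t := le_of_mul_le_mul_right (a := ‖w‖) (by linarith) hn
      have hat := sub_nonneg.2 hta
      have hs1' := sub_nonneg.2 hs1
      refine mem_convexHull_triple_iff.2 ⟨2 * t - a, b + 2 * (a - t) * (1 - s),
        c + 2 * (a - t) * s, by linarith, by positivity, by positivity, by linarith, ?_⟩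
      have hvw : w = ‖w‖ • v := by rw [hv, smul_inv_smul₀ hn.ne']
      rw [reflAt, hinner a b c h1]
      have : A - (1 - s) • B - s • C = ‖w‖ • v := by rw [← hvw, hw]; module
      linear_combination (norm := module) (2 * (t - a)) • this
  have hzv := hz
  simp only [unfolded, mem_iInter, mem_ofPred_eq, mem_sphere_zero_iff_norm] at hzv
  have := (hzv v hv1).trans hfold
  rw [hinner a b c habc] at this
  exact le_of_mul_le_mul_right (a := ‖w‖) (by linarith) hn

/-- the minimal unfolded region of a non-obtuse triangle is contained in its
medial triangle. -/
theorem unfolded_triangle_subset_medial (A B C : Euc 2)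
    (hindep : AffineIndependent ℝ ![A, B, C])
    (hA : 0 ≤ ⟪B - A, C - A⟫) (hB : 0 ≤ ⟪A - B, C - B⟫) (hC : 0 ≤ ⟪A - C, B - C⟫)
    (Ω : Set (Euc 2)) (hΩ : Ω = convexHull ℝ {A, B, C}) :
    unfolded Ω ⊆ convexHull ℝ {midpoint ℝ A B, midpoint ℝ B C, midpoint ℝ C A} := by
  subst hΩ
  intro x hx
  obtain ⟨a, b, c, h1, rfl⟩ : ∃ a b c : ℝ, a + b + c = 1 ∧ a • A + b • B + c • C = x := by
    have htop : affineSpan ℝ (range ![A, B, C]) = ⊤ :=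
      hindep.affineSpan_eq_top_iff_card_eq_finrank_add_one.2 (by simp)
    obtain ⟨w, hw, hx⟩ := eq_affineCombination_of_mem_affineSpan_of_fintype
      (htop ▸ AffineSubspace.mem_top ℝ _ x : x ∈ affineSpan ℝ (range ![A, B, C]))
    rw [Finset.affineCombination_eq_linear_combination _ _ _ hw] at hx
    rw [Fin.sum_univ_three] at hw hx
    exact ⟨w 0, w 1, w 2, hw, hx.symm⟩
  have hcol := affineIndependent_iff_not_collinear_set.1 hindep
  have e₁ : ({B, C, A} : Set (Euc 2)) = {A, B, C} := by grind
  have e₂ : ({C, A, B} : Set (Euc 2)) = {A, B, C} := by grind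
  have ha := barycentric_le_half_of_mem_unfolded hcol hB hC h1 hx
  have hb := barycentric_le_half_of_mem_unfolded (A := B) (B := C) (C := A) (a := b) (b := c)
    (c := a) (by rwa [e₁]) (by rwa [real_inner_comm]) hA
    (by linarith) (by rw [e₁]; convert hx using 1; abel)
  have hc := barycentric_le_half_of_mem_unfolded (A := C) (B := A) (C := B) (a := c) (b := a)
    (c := b) (by rwa [e₂]) (by rwa [real_inner_comm]) (by rwa [real_inner_comm])
    (by linarith) (by rw [e₂]; convert hx using 1; abel)
  refine mem_convexHull_triple_iff.2 ⟨1 - 2 * c, 1 - 2 * a, 1 - 2 * b, by linarith, by linarith,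
    by linarith, by linarith, ?_⟩
  rw [midpoint_eq_smul_add, midpoint_eq_smul_add, midpoint_eq_smul_add,
    show c = 1 - a - b by linarith]
  simp only [invOf_eq_inv]
  module
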